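/- Let a ∈ ℝ, A, B > 0. Define the frame E₁, E₂, E₃ : ℝ → ℝ³ by E₁(u) = (2Ae^{Bu}, 1 − A²e^{2Bu}, 0)/(1 + A²e^{2Bu}), E₂(u) = (0, 0, 1), E₃(u) = (1 − A²e^{2Bu}, −2Ae^{Bu}, 0)/(1 + A²e^{2Bu}), and let h(u) = 2ABe^{Bu}/(1 + A²e^{2Bu}). Then: (i) ⟨E₁,E₁⟩ = 1, ⟨E₂,E₂⟩ = −1, ⟨E₃,E₃⟩ = 1, and ⟨E₁,E₂⟩ = ⟨E₁,E₃⟩ = ⟨E₂,E₃⟩ = 0; (ii) E₁'(u) = h(u)·E₃(u), E₂'(u) = 0, and E₃'(u) = −h(u)·E₁(u); (iii) if moreover a ≠ 0 and B ≠ ±2a, the curve c(u) = ( e^{2au}/(2aB) , −Ae^{(2a+B)u}/(2B(2a+B)) + e^{(2a−B)u}/(2AB(2a−B)) , 0 ) satisfies c'(u) = ρ(u)·E₁(u), where ρ(u) = (e^{2au}/(2B))·(Ae^{Bu} + e^{−Bu}/A). -/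

import Mathlib

noncomputable section

open Real

/-- The Lorentzian inner product on `ℝ³ = ℝ × ℝ × ℝ`:
`⟨x, y⟩ = x₁y₁ + x₂y₂ − x₃y₃`. -/
def lint (x y : ℝ × ℝ × ℝ) : ℝ := x.1 * y.1 + x.2.1 * y.2.1 - x.2.2 * y.2.2

/-- The (spacelike) tangent vector `E₁` of the frame along the profile curve
(timelike case, signature pattern `δ = −ε = 1`). -/
def E1 (A B : ℝ) (u : ℝ) : ℝ × ℝ × ℝ :=
  (1 + A ^ 2 * Real.exp (2 * B * u))⁻¹ •
    ((2 * A * Real.exp (B * u), 1 - A ^ 2 * Real.exp (2 * B * u), 0) : ℝ × ℝ × ℝ)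

/-- The (timelike) tangent vector `E₂` of the frame. -/
def E2 (u : ℝ) : ℝ × ℝ × ℝ := (0, 0, 1)

/-- The (spacelike) unit normal `E₃` of the frame. -/
def E3 (A B : ℝ) (u : ℝ) : ℝ × ℝ × ℝ :=
  (1 + A ^ 2 * Real.exp (2 * B * u))⁻¹ •
    ((1 - A ^ 2 * Real.exp (2 * B * u), -(2 * A * Real.exp (B * u)), 0) : ℝ × ℝ × ℝ)

/-- The coefficient `h(u) = 2ABe^{Bu}/(1 + A²e^{2Bu})`. -/
def hcoef (A B : ℝ) (u : ℝ) : ℝ :=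
  2 * A * B * Real.exp (B * u) / (1 + A ^ 2 * Real.exp (2 * B * u))

/-- The profile curve `c(u) = X(u,0)` of the timelike intrinsic rotational ZMC
surface, generic case. -/
def profc (a A B : ℝ) (u : ℝ) : ℝ × ℝ × ℝ :=
  (Real.exp (2 * a * u) / (2 * a * B),
   -(A * Real.exp ((2 * a + B) * u) / (2 * B * (2 * a + B)))
      + Real.exp ((2 * a - B) * u) / (2 * A * B * (2 * a - B)),
   0)

/-- The conformal factor `ρ(u) = (e^{2au}/(2B))(Ae^{Bu} + e^{−Bu}/A)`. -/
def rhoT (a A B : ℝ) (u : ℝ) : ℝ :=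
  Real.exp (2 * a * u) / (2 * B) *
    (A * Real.exp (B * u) + Real.exp (-(B * u)) / A)

/-- The moving frame of the timelike intrinsic rotational ZMC surfaces along the
profile curve: orthonormality (with `E₂` timelike), the structure equations
`E₁' = hE₃`, `E₂' = 0`, `E₃' = −hE₁`, and `c' = ρE₁` in the generic case. -/
theorem stmt17 (a A B : ℝ) (hA : 0 < A) (hB : 0 < B) (u : ℝ) :
    (lint (E1 A B u) (E1 A B u) = 1 ∧
     lint (E2 u) (E2 u) = -1 ∧
     lint (E3 A B u) (E3 A B u) = 1 ∧
     lint (E1 A B u) (E2 u) = 0 ∧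
     lint (E1 A B u) (E3 A B u) = 0 ∧
     lint (E2 u) (E3 A B u) = 0) ∧
    (deriv (E1 A B) u = hcoef A B u • E3 A B u ∧
     deriv E2 u = 0 ∧
     deriv (E3 A B) u = -(hcoef A B u) • E1 A B u) ∧
    (a ≠ 0 → B ≠ 2 * a → B ≠ -(2 * a) →
      deriv (profc a A B) u = rhoT a A B u • E1 A B u) := by
  have hx : Real.exp (2 * B * u) = Real.exp (B * u) ^ 2 := by
    rw [← Real.exp_nat_mul]; congr 1; push_cast; ring
  have hpos : 0 < Real.exp (B * u) := Real.exp_pos _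
  have hD : 1 + A ^ 2 * Real.exp (B * u) ^ 2 ≠ 0 := by positivity
  have hlin : ∀ k : ℝ, HasDerivAt (fun t : ℝ => Real.exp (k * t)) (Real.exp (k * u) * k) u := by
    intro k
    have h := ((hasDerivAt_id u).const_mul k).exp
    simpa using h
  have hden : HasDerivAt (fun t : ℝ => (1 + A ^ 2 * Real.exp (2 * B * t))⁻¹)
      (-(A ^ 2 * (Real.exp (2 * B * u) * (2 * B))) / (1 + A ^ 2 * Real.exp (2 * B * u)) ^ 2) u :=
    (((hlin (2 * B)).const_mul (A ^ 2)).const_add 1).fun_inv (by rw [hx]; exact hD)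
  have hn1 : HasDerivAt (fun t : ℝ => 2 * A * Real.exp (B * t))
      (2 * A * (Real.exp (B * u) * B)) u := (hlin B).const_mul (2 * A)
  have hn2 : HasDerivAt (fun t : ℝ => 1 - A ^ 2 * Real.exp (2 * B * t))
      (-(A ^ 2 * (Real.exp (2 * B * u) * (2 * B)))) u :=
    ((hlin (2 * B)).const_mul (A ^ 2)).const_sub 1
  have h0 : HasDerivAt (fun _ : ℝ => (0 : ℝ)) 0 u := hasDerivAt_const _ _
  refine ⟨⟨?_, ?_, ?_, ?_, ?_, ?_⟩, ⟨?_, ?_, ?_⟩, ?_⟩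
  · simp only [lint, E1, hx, Prod.smul_mk, smul_eq_mul]
    field_simp
    ring
  · simp [lint, E2]
  · simp only [lint, E3, hx, Prod.smul_mk, smul_eq_mul]
    field_simp
    ring
  · simp [lint, E1, E2]
  · simp only [lint, E1, E3, hx, Prod.smul_mk, smul_eq_mul]
    ring
  · simp [lint, E3, E2]
  · have h := hden.fun_smul (hn1.prodMk (hn2.prodMk h0))
    refine (HasDerivAt.deriv (f := E1 A B) h).trans ?_
    simp only [E3, hcoef, hx, Prod.smul_mk, smul_eq_mul, Prod.mk_add_mk, Prod.mk.injEq]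
    refine ⟨?_, ?_, ?_⟩
    · field_simp
      ring
    · field_simp
      ring
    · ring
  · exact (hasDerivAt_const u ((0, 0, 1) : ℝ × ℝ × ℝ)).deriv
  · have h := hden.fun_smul (hn2.prodMk (hn1.fun_neg.prodMk h0))
    refine (HasDerivAt.deriv (f := E3 A B) h).trans ?_
    simp only [E1, hcoef, hx, Prod.smul_mk, smul_eq_mul, Prod.mk_add_mk, Prod.mk.injEq]
    refine ⟨?_, ?_, ?_⟩
    · field_simp
      ring
    · field_simp
      ring
    · ring
  · intro ha h1 h2
    have hm : 2 * a - B ≠ 0 := fun h => h1 (by linarith)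
    have hp : 2 * a + B ≠ 0 := fun h => h2 (by linarith)
    have h := ((hlin (2 * a)).div_const (2 * a * B)).prodMk
      (((((hlin (2 * a + B)).const_mul A).div_const (2 * B * (2 * a + B))).fun_neg.fun_add
        ((hlin (2 * a - B)).div_const (2 * A * B * (2 * a - B)))).prodMk h0)
    refine (HasDerivAt.deriv (f := profc a A B) h).trans ?_
    have e1 : Real.exp ((2 * a + B) * u) = Real.exp (2 * a * u) * Real.exp (B * u) := by
      rw [← Real.exp_add]; congr 1; ring
    have e2 : Real.exp ((2 * a - B) * u) = Real.exp (2 * a * u) * (Real.exp (B * u))⁻¹ := by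
      rw [← Real.exp_neg, ← Real.exp_add]; congr 1; ring
    simp only [E1, rhoT, hx, e1, e2, Real.exp_neg, Prod.smul_mk, smul_eq_mul, Prod.mk.injEq]
    refine ⟨?_, ?_, ?_⟩
    · field_simp
      ring
    · field_simp
      ring
    · ring
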